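/- Let L be a Boolean saturated orthomodular lattice and let a, c ∈ L be such that c is a complement of a (i.e., a ∧ c = 0 and a ∨ c = 1). Then ◇a = ◇(¬c). -/

import Mathlib

/-! Basic notions: orthomodular lattices, central elements, Boolean saturation,
modal extensions and possibility spaces. -/

/-- An orthomodular lattice: a bounded lattice with an involution `neg`
satisfying `x ⊓ neg x = ⊥` and the orthomodular law. -/
class OML (α : Type u) extends Lattice α, BoundedOrder α where
  neg : α → α
  neg_neg : ∀ x : α, neg (neg x) = x
  neg_sup : ∀ x y : α, neg (x ⊔ y) = neg x ⊓ neg y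
  inf_neg : ∀ x : α, x ⊓ neg x = ⊥
  orthomodular : ∀ x y : α, x ⊔ (neg x ⊓ (x ⊔ y)) = x ⊔ y

namespace OML

variable {α : Type u} [OML α]

/-- `(a,b,c)D` -/
def D (a b c : α) : Prop := (a ⊔ b) ⊓ c = (a ⊓ c) ⊔ (b ⊓ c)

/-- `(a,b,c)D*` -/
def Dstar (a b c : α) : Prop := (a ⊓ b) ⊔ c = (a ⊔ c) ⊓ (b ⊔ c)

/-- A central element: complemented and all permuted distributivity
conditions hold. -/
def IsCentral (z : α) : Prop :=
  (∃ c : α, z ⊓ c = ⊥ ∧ z ⊔ c = ⊤) ∧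
    ∀ a b : α, D a b z ∧ D a z b ∧ D z a b ∧ Dstar a b z ∧ Dstar a z b ∧ Dstar z a b

end OML

/-- `dia` is the possibility operator: `dia a` is the least central element above `a`. -/
def IsDiamond {α : Type u} [OML α] (dia : α → α) : Prop :=
  ∀ a : α, IsLeast {z : α | OML.IsCentral z ∧ a ≤ z} (dia a)

/-- A Boolean saturated orthomodular lattice: every `{z ∈ Z(L) : a ≤ z}` has a minimum. -/
def BooleanSaturated (α : Type u) [OML α] : Prop :=
  ∀ a : α, ∃ m : α, IsLeast {z : α | OML.IsCentral z ∧ a ≤ z} m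

/-- A Boolean sublattice: a sublattice containing `⊥, ⊤`, closed under `neg`,
and distributive. -/
structure IsBooleanSub {α : Type u} [OML α] (S : Set α) : Prop where
  bot_mem : (⊥ : α) ∈ S
  top_mem : (⊤ : α) ∈ S
  inf_mem : ∀ x ∈ S, ∀ y ∈ S, x ⊓ y ∈ S
  sup_mem : ∀ x ∈ S, ∀ y ∈ S, x ⊔ y ∈ S
  neg_mem : ∀ x ∈ S, OML.neg x ∈ S
  distrib : ∀ x ∈ S, ∀ y ∈ S, ∀ z ∈ S, x ⊓ (y ⊔ z) = (x ⊓ y) ⊔ (x ⊓ z)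

/-- A Boolean homomorphism into the two-element Boolean algebra `Bool`,
defined on the subset `S`. -/
def IsBoolHomOn {α : Type u} [OML α] (S : Set α) (v : α → Bool) : Prop :=
  v ⊥ = false ∧ v ⊤ = true ∧
    (∀ x ∈ S, ∀ y ∈ S, v (x ⊓ y) = (v x && v y)) ∧
    (∀ x ∈ S, ∀ y ∈ S, v (x ⊔ y) = (v x || v y)) ∧
    (∀ x ∈ S, v (OML.neg x) = !(v x))

/-- Membership in the sublattice generated by `X`. -/
inductive GenSub {α : Type u} [OML α] (X : Set α) : α → Prop
  | base : ∀ x ∈ X, GenSub X x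
  | inf : ∀ x y, GenSub X x → GenSub X y → GenSub X (x ⊓ y)
  | sup : ∀ x y, GenSub X x → GenSub X y → GenSub X (x ⊔ y)

/-- The embedding of a modal extension: injective and preserving `⊓, ⊔, neg, ⊥, ⊤`. -/
def IsOMLEmbedding {α : Type u} {β : Type v} [OML α] [OML β] (e : α → β) : Prop :=
  Function.Injective e ∧ e ⊥ = ⊥ ∧ e ⊤ = ⊤ ∧
    (∀ x y : α, e (x ⊓ y) = e x ⊓ e y) ∧
    (∀ x y : α, e (x ⊔ y) = e x ⊔ e y) ∧
    (∀ x : α, e (OML.neg x) = OML.neg (e x))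

/-- The possibility space `◇L`: the sublattice of `L^◇` generated by `{◇p : p ∈ L}`. -/
def PossSpace {α : Type u} {β : Type v} [OML α] [OML β] (e : α → β) (dia : β → β) : Set β :=
  {x : β | GenSub (Set.range fun p : α => dia (e p)) x}

/-- A global valuation: a compatible family of Boolean homomorphisms into `2`,
indexed by the Boolean sublattices. -/
def HasGlobalValuation (α : Type u) [OML α] : Prop :=
  ∃ v : Set α → α → Bool,
    (∀ W : Set α, IsBooleanSub W → IsBoolHomOn W (v W)) ∧
    (∀ W W' : Set α, IsBooleanSub W → IsBooleanSub W' → ∀ x ∈ W ∩ W', v W x = v W' x)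
namespace OML

variable {α : Type u} [OML α]

theorem neg_le_neg {x y : α} (h : x ≤ y) : neg y ≤ neg x := by
  rw [← sup_eq_right.mpr h, neg_sup]
  exact inf_le_left

theorem neg_le_comm {x y : α} : neg x ≤ y ↔ neg y ≤ x :=
  ⟨fun h => neg_neg x ▸ neg_le_neg h, fun h => neg_neg y ▸ neg_le_neg h⟩

theorem sup_neg (x : α) : x ⊔ neg x = ⊤ := by
  have hbot : neg (x ⊔ neg x) ≤ neg ⊤ := by
    rw [neg_sup, inf_neg]
    exact bot_le
  exact top_le_iff.mp (by simpa only [neg_neg] using neg_le_neg hbot)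

/-- A central element lies above `a` iff it lies above the orthocomplement of a complement
of `a`. -/
theorem IsCentral.le_iff_neg_le {z a c : α} (hz : IsCentral z)
    (hinf : a ⊓ c = ⊥) (hsup : a ⊔ c = ⊤) : a ≤ z ↔ neg c ≤ z := by
  rw [neg_le_comm]
  constructor
  · intro h
    have hd : (z ⊓ neg z) ⊔ c = (z ⊔ c) ⊓ (neg z ⊔ c) := (hz.2 (neg z) c).2.2.2.2.2
    have htop : z ⊔ c = ⊤ := top_le_iff.mp (hsup ▸ sup_le_sup_right h c)
    rw [inf_neg, bot_sup_eq, htop, top_inf_eq] at hd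
    exact le_sup_left.trans hd.ge
  · intro h
    have hd : (z ⊔ neg z) ⊓ a = (z ⊓ a) ⊔ (neg z ⊓ a) := (hz.2 (neg z) a).2.2.1
    have hbot : neg z ⊓ a = ⊥ :=
      le_bot_iff.mp (hinf ▸ le_inf inf_le_right (inf_le_left.trans h))
    rw [sup_neg, top_inf_eq, hbot, sup_bot_eq] at hd
    exact hd.le.trans inf_le_left

end OML

/-- In a Boolean saturated orthomodular lattice, if `c` is a
complement of `a` then `◇a = ◇(¬c)`. -/
theorem dia_eq_dia_neg_of_complement {α : Type u} [OML α]
    (dia : α → α) (hdia : IsDiamond dia)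
    (a c : α) (hinf : a ⊓ c = ⊥) (hsup : a ⊔ c = ⊤) :
    dia a = dia (OML.neg c) := by
  have hset : {z : α | OML.IsCentral z ∧ a ≤ z} = {z | OML.IsCentral z ∧ OML.neg c ≤ z} :=
    Set.ext fun _ => and_congr_right fun hz => hz.le_iff_neg_le hinf hsup
  exact (hset ▸ hdia a).unique (hdia (OML.neg c))
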